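/- arXiv:2201.13112 — 2 statements merged into one kernel-verified Lean document; each statement's English description precedes it below -/
import Mathlib

section
/- Let Ω be a finite nonempty set with m = |Ω|, let p be a probability measure on Ω, and let (W_i)_{i ≥ 1} be an i.i.d. sequence of Ω-valued random variables on a probability space, each with law p. For each integer t ≥ 1 and w ∈ Ω let p̂_t(w) = (1/t) · |{ i : 1 ≤ i ≤ t, W_i = w }| be the empirical distribution, and let δ ∈ (0,1) and λ_t = sqrt( (1/(2t)) · log( m π² t² / (3δ) ) ). Then with probability at least 1 − δ, simultaneously for every integer t ≥ 1 and every w ∈ Ω, |p̂_t(w) − p({w})| ≤ λ_t. -/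
open Real MeasureTheory ProbabilityTheory Classical

/-- The two-sided Hoeffding inequality for a sum of independent sub-Gaussian random variables. -/
theorem measureReal_le_abs_sum_range_le_of_iIndepFun
    {α : Type*} [MeasurableSpace α] {μ : Measure α} [IsProbabilityMeasure μ]
    {X : ℕ → α → ℝ} (hindep : iIndepFun X μ) {c : NNReal} {n : ℕ}
    (hX : ∀ i < n, HasSubgaussianMGF (X i) c μ) {ε : ℝ} (hε : 0 ≤ ε) :
    μ.real {ω | ε ≤ |∑ i ∈ Finset.range n, X i ω|} ≤ 2 * exp (-ε ^ 2 / (2 * n * c)) := by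
  have hupper := HasSubgaussianMGF.measure_sum_range_ge_le_of_iIndepFun hindep hX hε
  have hlower := HasSubgaussianMGF.measure_sum_range_ge_le_of_iIndepFun
    (X := fun i ω => -X i ω) (hindep.comp (fun _ x => -x) fun _ => measurable_neg)
    (fun i hi => (hX i hi).neg) hε
  calc μ.real {ω | ε ≤ |∑ i ∈ Finset.range n, X i ω|}
      ≤ μ.real ({ω | ε ≤ ∑ i ∈ Finset.range n, X i ω} ∪
          {ω | ε ≤ ∑ i ∈ Finset.range n, -X i ω}) := by
        refine measureReal_mono fun ω hω => ?_
        simpa [le_abs] using hω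
    _ ≤ _ := measureReal_union_le _ _
    _ ≤ _ := by linarith

/-- Hoeffding's inequality for the empirical frequency of a point among i.i.d. samples. -/
theorem measureReal_lt_abs_empirical_sub_le
    {Ω : Type*} [MeasurableSpace Ω] [MeasurableSingletonClass Ω]
    {α : Type*} [MeasurableSpace α] {μ : Measure α} [IsProbabilityMeasure μ]
    {p : Measure Ω} {W : ℕ → α → Ω} (hmeas : ∀ i, Measurable (W i))
    (hindep : iIndepFun W μ) (hlaw : ∀ i, μ.map (W i) = p)
    {t : ℕ} (ht : 0 < t) (w : Ω) {ε : ℝ} (hε : 0 ≤ ε) :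
    μ.real {ω | ε < |((Finset.range t).filter (fun i => W i ω = w)).card / (t : ℝ) -
      (p {w}).toReal|} ≤ 2 * exp (-2 * t * ε ^ 2) := by
  have ht' : (0 : ℝ) < t := by exact_mod_cast ht
  have hind : Measurable (({w} : Set Ω).indicator (1 : Ω → ℝ)) :=
    measurable_one.indicator (measurableSet_singleton w)
  have hmean : ∀ i, ∫ ω, ({w} : Set Ω).indicator (1 : Ω → ℝ) (W i ω) ∂μ = (p {w}).toReal := by
    intro i
    rw [← integral_map (hmeas i).aemeasurable hind.aestronglyMeasurable, hlaw i,
      integral_indicator_one (measurableSet_singleton w), measureReal_def]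
  have hsub : ∀ i < t, HasSubgaussianMGF
      (fun ω => ({w} : Set Ω).indicator (1 : Ω → ℝ) (W i ω) - (p {w}).toReal)
      ((‖(1 : ℝ) - 0‖₊ / 2) ^ 2) μ := by
    intro i _
    rw [← hmean i]
    refine hasSubgaussianMGF_of_mem_Icc (hind.comp (hmeas i)).aemeasurable (ae_of_all _ fun ω => ?_)
    by_cases h : W i ω = w <;> simp [h]
  have hsum := measureReal_le_abs_sum_range_le_of_iIndepFun
    (hindep.comp (fun _ x => ({w} : Set Ω).indicator (1 : Ω → ℝ) x - (p {w}).toReal)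
      fun _ => hind.sub_const _) hsub (mul_nonneg ht'.le hε)
  have hexp : -((t : ℝ) * ε) ^ 2 / (2 * t * (((‖(1 : ℝ) - 0‖₊ / 2) ^ 2 : NNReal) : ℝ)) =
      -2 * t * ε ^ 2 := by
    simp
    field_simp
  rw [hexp] at hsum
  refine (measureReal_mono fun ω hω => ?_).trans hsum
  have hcount : ∑ i ∈ Finset.range t,
      (({w} : Set Ω).indicator (1 : Ω → ℝ) (W i ω) - (p {w}).toReal) =
      t * (((Finset.range t).filter (fun i => W i ω = w)).card / (t : ℝ) - (p {w}).toReal) := by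
    rw [mul_sub, mul_div_cancel₀ _ ht'.ne']
    simp [Finset.sum_sub_distrib, Set.indicator_apply, Finset.sum_boole]
  simp only [Set.mem_ofPred_eq, Function.comp_apply] at hω ⊢
  rw [hcount, abs_mul, abs_of_pos ht']
  exact mul_le_mul_of_nonneg_left hω.le ht'.le

/-- Hoeffding's exponential bound at the confidence radius `λ_t`. -/
theorem two_mul_exp_neg_sq_confidence_radius {m t δ : ℝ} (hm : 1 ≤ m) (ht : 1 ≤ t)
    (hδ : 0 < δ) (hδ' : δ ≤ 1) :
    2 * exp (-2 * t * √(1 / (2 * t) * log (m * π ^ 2 * t ^ 2 / (3 * δ))) ^ 2) =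
      6 * δ / (π ^ 2 * m) * (1 / t ^ 2) := by
  have ht0 : 0 < t := by linarith
  have hm0 : 0 < m := by linarith
  have hlog : 0 ≤ log (m * π ^ 2 * t ^ 2 / (3 * δ)) := by
    refine log_nonneg ?_
    rw [le_div_iff₀ (by positivity)]
    have hπ : 3 ≤ π ^ 2 := by nlinarith [pi_gt_three]
    calc 1 * (3 * δ) ≤ 1 * 3 * 1 := by linarith
      _ ≤ m * π ^ 2 * t ^ 2 := by
        gcongr
        exact one_le_pow₀ ht
  rw [sq_sqrt (by positivity)]
  have harg : -2 * t * (1 / (2 * t) * log (m * π ^ 2 * t ^ 2 / (3 * δ))) =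
      -log (m * π ^ 2 * t ^ 2 / (3 * δ)) := by
    field_simp
  rw [harg, exp_neg, exp_log (by positivity)]
  field_simp
  norm_num

/-- Uniform Hoeffding bound for the empirical distribution: with probability at
least `1 − δ`, simultaneously for every `t ≥ 1` and every `w ∈ Ω`, the empirical
frequency of `w` among the first `t` i.i.d. samples deviates from `p({w})` by at
most `λ_t = sqrt((1/(2t)) log(m π² t² / (3δ)))`, where `m = |Ω|`. -/
theorem empirical_uniform_hoeffding
    {Ω : Type*} [Fintype Ω] [Nonempty Ω] [MeasurableSpace Ω] [MeasurableSingletonClass Ω]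
    {α : Type*} [MeasurableSpace α] (μ : Measure α) [IsProbabilityMeasure μ]
    (p : Measure Ω) [IsProbabilityMeasure p]
    (W : ℕ → α → Ω) (hmeas : ∀ i, Measurable (W i))
    (hindep : iIndepFun W μ)
    (hlaw : ∀ i, μ.map (W i) = p)
    (δ : ℝ) (hδ : δ ∈ Set.Ioo (0:ℝ) 1) :
    ENNReal.ofReal (1 - δ) ≤
      μ {ω | ∀ t : ℕ, 1 ≤ t → ∀ w : Ω,
        |((Finset.range t).filter (fun i => W i ω = w)).card / (t : ℝ) - (p {w}).toReal| ≤
          Real.sqrt ((1 / (2 * (t : ℝ))) *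
            Real.log ((Fintype.card Ω : ℝ) * π ^ 2 * (t : ℝ) ^ 2 / (3 * δ)))} := by
  obtain ⟨hδ0, hδ1⟩ := hδ
  set m : ℝ := (Fintype.card Ω : ℝ) with hm_def
  have hm : 1 ≤ m := Nat.one_le_cast.2 Fintype.card_pos
  set good := {ω | ∀ t : ℕ, 1 ≤ t → ∀ w : Ω,
    |((Finset.range t).filter (fun i => W i ω = w)).card / (t : ℝ) - (p {w}).toReal| ≤
      √(1 / (2 * (t : ℝ)) * log (m * π ^ 2 * (t : ℝ) ^ 2 / (3 * δ)))} with hgood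
  let bad : ℕ → Ω → Set α := fun t w => {ω | 1 ≤ t ∧
    √(1 / (2 * (t : ℝ)) * log (m * π ^ 2 * (t : ℝ) ^ 2 / (3 * δ))) <
      |((Finset.range t).filter (fun i => W i ω = w)).card / (t : ℝ) - (p {w}).toReal|}
  have hcompl : goodᶜ ⊆ ⋃ t, ⋃ w, bad t w := by
    intro ω hω
    simpa [hgood, bad] using hω
  have hbad : ∀ t w, μ (bad t w) ≤
      ENNReal.ofReal (6 * δ / (π ^ 2 * m) * (1 / (t : ℝ) ^ 2)) := by
    intro t w
    rcases Nat.eq_zero_or_pos t with rfl | ht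
    · simp [bad]
    · rw [← two_mul_exp_neg_sq_confidence_radius hm (Nat.one_le_cast.2 ht) hδ0 hδ1.le]
      refine (measure_mono fun ω hω => hω.2).trans ?_
      exact (ENNReal.le_ofReal_iff_toReal_le (measure_ne_top _ _) (by positivity)).2
        (measureReal_lt_abs_empirical_sub_le hmeas hindep hlaw ht w (sqrt_nonneg _))
  have hzeta : HasSum (fun t : ℕ => m * (6 * δ / (π ^ 2 * m) * (1 / (t : ℝ) ^ 2))) δ := by
    have hδ_eq : m * (6 * δ / (π ^ 2 * m) * (π ^ 2 / 6)) = δ := by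
      have hm0 : m ≠ 0 := by linarith
      field_simp
    have hsum := (hasSum_zeta_two.mul_left (6 * δ / (π ^ 2 * m))).mul_left m
    rwa [hδ_eq] at hsum
  have hunion : μ goodᶜ ≤ ENNReal.ofReal δ := by
    calc μ goodᶜ ≤ ∑' t, μ (⋃ w, bad t w) := (measure_mono hcompl).trans (measure_iUnion_le _)
      _ ≤ ∑' t : ℕ, ENNReal.ofReal (m * (6 * δ / (π ^ 2 * m) * (1 / (t : ℝ) ^ 2))) := by
        refine ENNReal.tsum_le_tsum fun t => (measure_iUnion_fintype_le _ _).trans ?_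
        refine (Finset.sum_le_sum fun w _ => hbad t w).trans_eq ?_
        rw [Finset.sum_const, Finset.card_univ, nsmul_eq_mul, hm_def,
          ENNReal.ofReal_mul (Nat.cast_nonneg _), ENNReal.ofReal_natCast]
      _ = ENNReal.ofReal δ := by
        rw [← ENNReal.ofReal_tsum_of_nonneg (fun t => by positivity) hzeta.summable,
          hzeta.tsum_eq]
  rw [ENNReal.ofReal_sub _ hδ0.le, ENNReal.ofReal_one, tsub_le_iff_right]
  calc (1 : ENNReal) = μ (good ∪ goodᶜ) := by rw [Set.union_compl_self, measure_univ]
    _ ≤ μ good + μ goodᶜ := measure_union_le _ _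
    _ ≤ μ good + ENNReal.ofReal δ := by gcongr
end

section
/- Let Ω be a finite nonempty set with m = |Ω|, let p be a probability measure on Ω, and let (W_i)_{i ≥ 1} be an i.i.d. sequence of Ω-valued random variables on a probability space, each with law p. For each integer t ≥ 1 and w ∈ Ω let p̂_t(w) = (1/t) · |{ i : 1 ≤ i ≤ t, W_i = w }| be the empirical distribution, and for δ ∈ (0,1) let ε_t = m · sqrt( (1/(2t)) · log( m π² t² / (3δ) ) ). Then with probability at least 1 − δ, for every integer t ≥ 1 one has ∑_{w ∈ Ω} |p̂_t(w) − p({w})| ≤ ε_t; that is, the true distribution lies in the L1 ambiguity set of radius ε_t around the empirical distribution simultaneously for all t. -/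
open Real MeasureTheory ProbabilityTheory Classical

/-- **Hoeffding's inequality**, two-sided, for the average of independent random variables with
values in `[0, 1]` and a common mean. -/
lemma measureReal_le_abs_average_sub_mean_le {α : Type*} [MeasurableSpace α] {μ : Measure α}
    [IsProbabilityMeasure μ] {X : ℕ → α → ℝ} (hX : ∀ i, Measurable (X i))
    (hindep : iIndepFun X μ) (hmem : ∀ i ω, X i ω ∈ Set.Icc (0 : ℝ) 1) {c : ℝ}
    (hmean : ∀ i, ∫ ω, X i ω ∂μ = c) {t : ℕ} (ht : 1 ≤ t) {r : ℝ} (hr : 0 ≤ r) :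
    μ.real {ω | r ≤ |(∑ i ∈ Finset.range t, X i ω) / (t : ℝ) - c|} ≤
      2 * Real.exp (-(2 * t * r ^ 2)) := by
  have ht0 : (0 : ℝ) < t := by exact_mod_cast ht
  have hsub : ∀ i, HasSubgaussianMGF (fun ω => X i ω - c) ((‖(1 : ℝ) - 0‖₊ / 2) ^ 2) μ := by
    intro i
    have h := hasSubgaussianMGF_of_mem_Icc (hX i).aemeasurable
      (Filter.Eventually.of_forall (hmem i) : ∀ᵐ ω ∂μ, X i ω ∈ Set.Icc (0 : ℝ) 1)
    rwa [hmean i] at h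
  have hind₁ : iIndepFun (fun i ω => X i ω - c) μ :=
    hindep.comp (fun _ x => x - c) (fun _ => measurable_id.sub_const c)
  have hind₂ : iIndepFun (fun i => -fun ω => X i ω - c) μ :=
    hind₁.comp (fun _ x => -x) (fun _ => measurable_neg)
  have hexp : -((t : ℝ) * r) ^ 2 / (2 * t * (((‖(1 : ℝ) - 0‖₊ / 2) ^ 2 : NNReal) : ℝ)) =
      -(2 * t * r ^ 2) := by
    simp
    field_simp
  have h₁ := HasSubgaussianMGF.measure_sum_range_ge_le_of_iIndepFun hind₁ (n := t) (fun i _ => hsub i)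
    (mul_nonneg ht0.le hr)
  have h₂ := HasSubgaussianMGF.measure_sum_range_ge_le_of_iIndepFun hind₂ (n := t) (fun i _ => (hsub i).neg)
    (mul_nonneg ht0.le hr)
  rw [hexp] at h₁ h₂
  refine (measureReal_mono (fun ω hω => ?_)).trans
    ((measureReal_union_le _ _).trans ((add_le_add h₁ h₂).trans_eq (two_mul _).symm))
  have hdiv : (∑ i ∈ Finset.range t, X i ω) / (t : ℝ) - c =
      (∑ i ∈ Finset.range t, (X i ω - c)) / t := by
    rw [Finset.sum_sub_distrib]
    simp
    field_simp
  rw [Set.mem_ofPred_eq, hdiv, le_abs, ← neg_div, le_div_iff₀ ht0, le_div_iff₀ ht0] at hω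
  simpa [mul_comm r, Finset.sum_neg_distrib, neg_sub] using hω

/-- Concentration of the empirical frequency of a single point. -/
lemma measureReal_le_abs_empirical_sub_le {Ω : Type*} [MeasurableSpace Ω]
    [MeasurableSingletonClass Ω] {α : Type*} [MeasurableSpace α] {μ : Measure α}
    [IsProbabilityMeasure μ] {p : Measure Ω} {W : ℕ → α → Ω} (hmeas : ∀ i, Measurable (W i))
    (hindep : iIndepFun W μ) (hlaw : ∀ i, μ.map (W i) = p) (w : Ω) {t : ℕ} (ht : 1 ≤ t)
    {r : ℝ} (hr : 0 ≤ r) :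
    μ.real {ω | r ≤ |((Finset.range t).filter (fun i => W i ω = w)).card / (t : ℝ) -
      (p {w}).toReal|} ≤ 2 * Real.exp (-(2 * t * r ^ 2)) := by
  have hf : Measurable (Set.indicator {w} (fun _ : Ω => (1 : ℝ))) :=
    measurable_const.indicator (measurableSet_singleton w)
  have h := measureReal_le_abs_average_sub_mean_le (μ := μ) (c := (p {w}).toReal)
    (X := fun i ω => Set.indicator {w} (fun _ : Ω => (1 : ℝ)) (W i ω))
    (fun i => hf.comp (hmeas i)) (hindep.comp (fun _ => Set.indicator {w} fun _ => (1 : ℝ))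
      (fun _ => hf))
    (fun i ω => by by_cases h : W i ω = w <;> simp [h])
    (fun i => by
      rw [← integral_map (hmeas i).aemeasurable hf.aestronglyMeasurable, hlaw i,
        integral_indicator_const _ (measurableSet_singleton w)]
      simp [Measure.real]) ht hr
  simpa [Set.indicator_apply, Finset.sum_boole] using h

/-- With probability at least `1 − δ`, the true distribution lies in the L1
ambiguity set of radius `ε_t = m sqrt((1/(2t)) log(m π² t² / (3δ)))` around the
empirical distribution of the first `t` i.i.d. samples, simultaneously for all
`t ≥ 1`, where `m = |Ω|`. -/
theorem empirical_L1_ball_contains_true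
    {Ω : Type*} [Fintype Ω] [Nonempty Ω] [MeasurableSpace Ω] [MeasurableSingletonClass Ω]
    {α : Type*} [MeasurableSpace α] (μ : Measure α) [IsProbabilityMeasure μ]
    (p : Measure Ω) [IsProbabilityMeasure p]
    (W : ℕ → α → Ω) (hmeas : ∀ i, Measurable (W i))
    (hindep : iIndepFun W μ)
    (hlaw : ∀ i, μ.map (W i) = p)
    (δ : ℝ) (hδ : δ ∈ Set.Ioo (0:ℝ) 1) :
    ENNReal.ofReal (1 - δ) ≤
      μ {ω | ∀ t : ℕ, 1 ≤ t →
        ∑ w : Ω, |((Finset.range t).filter (fun i => W i ω = w)).card / (t : ℝ) -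
            (p {w}).toReal| ≤
          (Fintype.card Ω : ℝ) * Real.sqrt ((1 / (2 * (t : ℝ))) *
            Real.log ((Fintype.card Ω : ℝ) * π ^ 2 * (t : ℝ) ^ 2 / (3 * δ)))} := by
  obtain ⟨hδ0, hδ1⟩ := hδ
  set m : ℝ := (Fintype.card Ω : ℝ) with hm
  have hm1 : (1 : ℝ) ≤ m := Nat.one_le_cast.2 Fintype.card_pos
  let r : ℕ → ℝ := fun t => Real.sqrt ((1 / (2 * (t : ℝ))) *
    Real.log (m * π ^ 2 * (t : ℝ) ^ 2 / (3 * δ)))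
  let B : ℕ → Ω → Set α := fun n w =>
    {ω | r (n + 1) ≤ |((Finset.range (n + 1)).filter (fun i => W i ω = w)).card /
      ((n + 1 : ℕ) : ℝ) - (p {w}).toReal|}
  have htail : ∀ n w, μ (B n w) ≤
      ENNReal.ofReal (6 * δ / (m * π ^ 2) * (1 / ((n + 1 : ℕ) : ℝ) ^ 2)) := by
    intro n w
    have ht : (1 : ℝ) ≤ ((n + 1 : ℕ) : ℝ) := by simp
    have harg : 1 ≤ m * π ^ 2 * ((n + 1 : ℕ) : ℝ) ^ 2 / (3 * δ) := by
      rw [one_le_div (by positivity)]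
      have hπ : (3 : ℝ) ≤ π ^ 2 := by nlinarith [Real.pi_gt_three]
      have h₁ : (3 : ℝ) ≤ m * π ^ 2 := by nlinarith
      nlinarith [one_le_pow₀ ht (n := 2)]
    have h := measureReal_le_abs_empirical_sub_le hmeas hindep hlaw w (Nat.le_add_left 1 n)
      (Real.sqrt_nonneg ((1 / (2 * ((n + 1 : ℕ) : ℝ))) *
        Real.log (m * π ^ 2 * ((n + 1 : ℕ) : ℝ) ^ 2 / (3 * δ))))
    rw [Real.sq_sqrt (mul_nonneg (by positivity) (Real.log_nonneg harg)), ← mul_assoc,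
      mul_one_div_cancel (by positivity), one_mul, Real.exp_neg,
      Real.exp_log (by positivity)] at h
    rw [← ofReal_measureReal]
    refine ENNReal.ofReal_le_ofReal (h.trans_eq ?_)
    field_simp
    norm_num
  have hsum : HasSum (fun n : ℕ => 6 * δ / π ^ 2 * (1 / ((n + 1 : ℕ) : ℝ) ^ 2)) δ := by
    have h := ((hasSum_nat_add_iff' 1).2 hasSum_zeta_two).mul_left (6 * δ / π ^ 2)
    convert! h using 1
    simp
    field_simp
  have hbad : μ (⋃ n, ⋃ w, B n w) ≤ ENNReal.ofReal δ := by
    rw [← hsum.tsum_eq, ENNReal.ofReal_tsum_of_nonneg (fun n => by positivity) hsum.summable]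
    refine (measure_iUnion_le _).trans (ENNReal.tsum_le_tsum fun n => ?_)
    refine (measure_iUnion_fintype_le _ _).trans
      ((Finset.sum_le_sum fun w _ => htail n w).trans_eq ?_)
    rw [← ENNReal.ofReal_sum_of_nonneg (fun w _ => by positivity)]
    congr 1
    simp only [Finset.sum_const, Finset.card_univ, nsmul_eq_mul, ← hm]
    field_simp
  calc ENNReal.ofReal (1 - δ) = 1 - ENNReal.ofReal δ := by
        rw [ENNReal.ofReal_sub _ hδ0.le, ENNReal.ofReal_one]
    _ ≤ 1 - μ (⋃ n, ⋃ w, B n w) := tsub_le_tsub_left hbad _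
    _ ≤ μ (⋃ n, ⋃ w, B n w)ᶜ := by
        rw [tsub_le_iff_left, ← measure_univ (μ := μ)]
        exact measure_univ_le_add_compl _
    _ ≤ _ := by
        refine measure_mono fun ω hω t ht => ?_
        obtain ⟨n, rfl⟩ : ∃ n, t = n + 1 := ⟨t - 1, by omega⟩
        simp only [Set.mem_compl_iff, Set.mem_iUnion, not_exists] at hω
        refine (Finset.sum_le_card_nsmul _ _ (r (n + 1))
          fun w _ => (not_le.1 (hω n w)).le).trans_eq ?_
        rw [Finset.card_univ, nsmul_eq_mul]
end
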